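/- arXiv:2106.08255 — 2 statements merged into one kernel-verified Lean document; each statement's English description precedes it below -/
import Mathlib

section
/- Let 1 < p ≤ 2 ≤ q < ∞ and set δ := 1 − 1/p − 1/q. If 0 ≤ δ < 1, then there exists a constant C = C(p,q) < ∞ such that ‖ĝ‖_{L^q(ℝ)} ≤ C ‖f‖_{L^p(ℝ)} for every Schwartz function f : ℝ → ℂ, where g(x) := f(x) |x|^{−δ} (note g ∈ L¹(ℝ), so its Fourier transform ĝ(ξ) = ∫_ℝ g(x) e^{−iξx} dx is defined pointwise). -/
open MeasureTheory
open scoped ENNReal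

noncomputable section

open scoped FourierTransform SchwartzMap ContDiff

/-- The Fourier transform with the normalization of the statement. -/
def FTr (g : ℝ → ℂ) (ξ : ℝ) : ℂ :=
  ∫ x : ℝ, g x * Complex.exp (-(Complex.I * ((ξ * x : ℝ) : ℂ)))

lemma FTr_eq (g : ℝ → ℂ) (ξ : ℝ) : FTr g ξ = 𝓕 g ((2 * Real.pi)⁻¹ * ξ) := by
  rw [Real.fourier_real_eq_integral_exp_smul, FTr]
  congr with x
  rw [smul_eq_mul, mul_comm]
  congr 2
  have : (Real.pi : ℂ) ≠ 0 := by exact_mod_cast Real.pi_ne_zero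
  push_cast
  field_simp

lemma continuous_fourier_aux {g : ℝ → ℂ} (hg : Integrable g) : Continuous (𝓕 g) :=
  VectorFourier.fourierIntegral_continuous Real.continuous_fourierChar
    (innerSL ℝ).continuous₂ hg

lemma FTr_continuous {g : ℝ → ℂ} (hg : Integrable g) : Continuous (FTr g) := by
  have : FTr g = fun ξ => 𝓕 g ((2 * Real.pi)⁻¹ * ξ) := funext (FTr_eq g)
  rw [this]
  exact (continuous_fourier_aux hg).comp (by fun_prop)

lemma norm_exp_aux (ξ x : ℝ) : ‖Complex.exp (-(Complex.I * ((ξ * x : ℝ) : ℂ)))‖ = 1 := by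
  have : -(Complex.I * ((ξ * x : ℝ) : ℂ)) = ((-(ξ * x) : ℝ) : ℂ) * Complex.I := by
    push_cast; ring
  rw [this, Complex.norm_exp_ofReal_mul_I]

lemma FTr_integrand {g : ℝ → ℂ} (hg : Integrable g) (ξ : ℝ) :
    Integrable (fun x : ℝ => g x * Complex.exp (-(Complex.I * ((ξ * x : ℝ) : ℂ)))) := by
  refine hg.mul_bdd (c := 1) ?_ ?_
  · exact (by fun_prop : Continuous fun x : ℝ =>
      Complex.exp (-(Complex.I * ((ξ * x : ℝ) : ℂ)))).aestronglyMeasurable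
  · exact Filter.Eventually.of_forall fun x => (norm_exp_aux ξ x).le

lemma FTr_add {g h : ℝ → ℂ} (hg : Integrable g) (hh : Integrable h) (ξ : ℝ) :
    FTr (g + h) ξ = FTr g ξ + FTr h ξ := by
  unfold FTr
  rw [← integral_add (FTr_integrand hg ξ) (FTr_integrand hh ξ)]
  congr with x
  simp [add_mul]

lemma FTr_norm_le (g : ℝ → ℂ) (ξ : ℝ) :
    ENNReal.ofReal ‖FTr g ξ‖ ≤ ∫⁻ x, ‖g x‖ₑ := by
  rw [ofReal_norm]
  refine (enorm_integral_le_lintegral_enorm _).trans (le_of_eq ?_)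
  congr with x
  rw [enorm_mul, ← ofReal_norm (Complex.exp _), norm_exp_aux]
  simp

lemma plancherel_aux {g : ℝ → ℂ} (hg : Integrable g) (hg2 : MemLp g 2) :
    eLpNorm (𝓕 g) 2 volume = eLpNorm g 2 volume := by
  set G : Lp ℂ 2 (volume : Measure ℝ) := hg2.toLp g with hG
  have key : (𝓕 G : Lp ℂ 2 (volume : Measure ℝ)) =ᵐ[volume] 𝓕 g := by
    apply ae_eq_of_integral_contDiff_smul_eq
    · exact (Lp.memLp _).locallyIntegrable (by norm_num)
    · exact (continuous_fourier_aux hg).locallyIntegrable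
    · intro φ φ_smooth φ_cpt
      have h₁ : HasCompactSupport (Complex.ofRealCLM ∘ φ) := φ_cpt.comp_left rfl
      have h₂ : ContDiff ℝ ∞ (Complex.ofRealCLM ∘ φ) := by fun_prop
      set Φ : 𝓢(ℝ, ℂ) := h₁.toSchwartzMap h₂ with hΦ
      have hΦx : ∀ x, Φ x = (φ x : ℂ) := fun x => by simp [hΦ]
      have e1 : ((𝓕 G : Lp ℂ 2 (volume : Measure ℝ)) : 𝓢'(ℝ, ℂ)) Φ = ((G : Lp ℂ 2 (volume : Measure ℝ)) : 𝓢'(ℝ, ℂ)) (𝓕 Φ) := by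
        rw [← Lp.fourier_toTemperedDistribution_eq, TemperedDistribution.fourier_apply]
      rw [Lp.toTemperedDistribution_apply, Lp.toTemperedDistribution_apply] at e1
      have e2 : ∫ x, (𝓕 Φ) x • G x = ∫ x, (𝓕 Φ) x • g x := by
        apply integral_congr_ae
        filter_upwards [hg2.coeFn_toLp] with x hx
        rw [hx]
      have e3 : ∫ x, (𝓕 Φ) x • g x = ∫ x, Φ x • (𝓕 g) x := by
        simpa using! VectorFourier.integral_fourierIntegral_smul_eq_flip (L := innerₗ ℝ)
          Real.continuous_fourierChar continuous_inner Φ.integrable hg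
      calc _ = ∫ x, Φ x • (𝓕 G : Lp ℂ 2 (volume : Measure ℝ)) x := by
              congr with x
        _ = ∫ x, Φ x • (𝓕 g) x := by rw [e1, e2, e3]
        _ = _ := by congr with x
  rw [← eLpNorm_congr_ae key, ← eLpNorm_congr_ae hg2.coeFn_toLp]
  have := Lp.norm_fourier_eq G
  rw [Lp.norm_def, Lp.norm_def] at this
  exact (ENNReal.toReal_eq_toReal_iff' (Lp.eLpNorm_ne_top _) (Lp.eLpNorm_ne_top _)).1 this

lemma lintegral_sq_eq (h : ℝ → ℂ) : eLpNorm h 2 volume ^ 2 = ∫⁻ x, ‖h x‖ₑ ^ 2 := by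
  rw [eLpNorm_eq_lintegral_rpow_enorm_toReal (by norm_num) (by norm_num)]
  rw [← ENNReal.rpow_natCast, ← ENNReal.rpow_mul]
  simp

lemma FTr_L2 {g : ℝ → ℂ} (hg : Integrable g) :
    ∫⁻ ξ, ‖FTr g ξ‖ₑ ^ 2 ≤ ENNReal.ofReal (2 * Real.pi) * ∫⁻ x, ‖g x‖ₑ ^ 2 := by
  by_cases hfin : ∫⁻ x, ‖g x‖ₑ ^ 2 = ⊤
  · rw [hfin, ENNReal.mul_top (by simp [Real.pi_pos])]
    exact le_top
  have hg2 : MemLp g 2 := by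
    refine ⟨hg.aestronglyMeasurable, ?_⟩
    rw [← lintegral_sq_eq] at hfin
    exact lt_top_iff_ne_top.2 fun h => hfin (by simp [h])
  have h2 := congrArg (· ^ 2) (plancherel_aux hg hg2)
  simp only [lintegral_sq_eq] at h2
  have hm : Measurable fun x => ‖𝓕 g x‖ₑ ^ 2 := by
    have := (continuous_fourier_aux hg).measurable
    fun_prop
  have h3 : ∫⁻ ξ, ‖FTr g ξ‖ₑ ^ 2 = ∫⁻ y, ‖𝓕 g y‖ₑ ^ 2 ∂(Measure.map ((2 * Real.pi)⁻¹ * ·) volume) := by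
    rw [lintegral_map hm (by fun_prop)]
    simp_rw [FTr_eq]
  rw [h3, Real.map_volume_mul_left (by positivity), lintegral_smul_measure, h2, smul_eq_mul,
    inv_inv, abs_of_pos (by positivity)]

lemma ptw {p q δ M r t a y : ℝ} (hp1 : 1 < p) (hp2 : p ≤ 2)
    (hδ : δ * (p * q) = p * q - q - p) (hδ0 : 0 ≤ δ) (hM0 : 0 < M) (hr : 0 < r) (ht : 0 < t)
    (ha : 0 < a) (hy0 : 0 < y) (hM : (4 : ℝ) ^ (2 - p) < M ^ (p - 1) * r ^ (δ * p))
    (hA : M * y ^ (2 * δ) ≤ a ^ (2 - p) * t ^ (q - 2)) (hy : r * t ^ q ≤ y) :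
    a * y ^ (-δ) ≤ t / 4 * a ^ p := by
  have l1 := Real.log_lt_log (by positivity) hM
  rw [Real.log_mul (by positivity) (by positivity), Real.log_rpow (by positivity),
    Real.log_rpow hM0, Real.log_rpow hr] at l1
  have l2 := Real.log_le_log (by positivity) hA
  rw [Real.log_mul (by positivity) (by positivity), Real.log_mul (by positivity) (by positivity),
    Real.log_rpow hy0, Real.log_rpow ha, Real.log_rpow ht] at l2
  have l3 := Real.log_le_log (by positivity) hy
  rw [Real.log_mul (by positivity) (by positivity), Real.log_rpow ht] at l3
  rw [← Real.log_le_log_iff (by positivity) (by positivity),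
    Real.log_mul (by positivity) (by positivity), Real.log_mul (by positivity) (by positivity),
    Real.log_rpow hy0, Real.log_rpow ha, Real.log_div (by positivity) (by positivity)]
  generalize Real.log a = a' at *
  generalize Real.log y = y' at *
  generalize Real.log t = t' at *
  generalize Real.log M = m at *
  generalize Real.log r = r' at *
  generalize Real.log 4 = l at *
  by_contra! hX
  have hX' : (p - 1) * a' + δ * y' + t' - l < 0 := by linarith
  have h1 : (2 - p) * ((p - 1) * a' + δ * y' + t' - l) ≤ 0 :=
    mul_nonpos_of_nonneg_of_nonpos (by linarith) hX'.le
  have h2 := mul_le_mul_of_nonneg_left l2 (by linarith : 0 ≤ p - 1)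
  have h3 := mul_le_mul_of_nonneg_left l3 (by positivity : 0 ≤ δ * p)
  have h4 : δ * p * (q * t') = (p * q - q - p) * t' := by rw [← hδ]; ring
  nlinarith

lemma lint_pow {u R : ℝ} (hu : -1 < u) (hR : 0 ≤ R) :
    ∫⁻ t in Set.Ioo 0 R, ENNReal.ofReal (t ^ u) = ENNReal.ofReal (R ^ (u + 1) / (u + 1)) := by
  have hi : IntegrableOn (fun t : ℝ => t ^ u) (Set.Ioo 0 R) := by
    have := (intervalIntegral.intervalIntegrable_rpow' hu (a := 0) (b := R))
    rw [intervalIntegrable_iff_integrableOn_Ioo_of_le hR] at this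
    exact this
  rw [← ofReal_integral_eq_lintegral_ofReal hi]
  · rw [← integral_Ioc_eq_integral_Ioo, ← intervalIntegral.integral_of_le hR,
      integral_rpow (Or.inl hu), Real.zero_rpow (by linarith), sub_zero]
  · filter_upwards [self_mem_ae_restrict measurableSet_Ioo] with t ht
    exact Real.rpow_nonneg ht.1.le _

lemma lint_ball {u R : ℝ} (hu : -1 < u) (hR : 0 < R) :
    ∫⁻ t in Set.Ioo (-R) R, ENNReal.ofReal (|t| ^ u) ≤
      ENNReal.ofReal (2 / (u + 1) * R ^ (u + 1)) := by
  have hpos : ∫⁻ t in Set.Ioo 0 R, ENNReal.ofReal (|t| ^ u) =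
      ENNReal.ofReal (R ^ (u + 1) / (u + 1)) := by
    rw [← lint_pow hu hR.le]
    refine setLIntegral_congr_fun measurableSet_Ioo fun t ht => ?_
    simp only [abs_of_pos ht.1]
  have hneg : ∫⁻ t in Set.Ioo (-R) 0, ENNReal.ofReal (|t| ^ u) =
      ENNReal.ofReal (R ^ (u + 1) / (u + 1)) := by
    rw [← hpos]
    have := (Measure.measurePreserving_neg (volume : Measure ℝ)).setLIntegral_comp_preimage
      (s := Set.Ioo 0 R) (f := fun t => ENNReal.ofReal (|t| ^ u)) measurableSet_Ioo (by fun_prop)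
    rw [← this]
    simp
  have hsub : Set.Ioo (-R) R ⊆ (Set.Ioo (-R) 0 ∪ Set.Ioo 0 R) ∪ {0} := by
    intro x hx
    rcases lt_trichotomy x 0 with h | h | h
    · exact Or.inl (Or.inl ⟨hx.1, h⟩)
    · exact Or.inr h
    · exact Or.inl (Or.inr ⟨h, hx.2⟩)
  have hu' : 0 < u + 1 := by linarith
  calc _ ≤ ∫⁻ t in (Set.Ioo (-R) 0 ∪ Set.Ioo 0 R) ∪ {0}, ENNReal.ofReal (|t| ^ u) :=
        lintegral_mono_set hsub
    _ ≤ _ := lintegral_union_le _ _ _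
    _ ≤ ((∫⁻ t in (Set.Ioo (-R) 0), ENNReal.ofReal (|t| ^ u)) +
          ∫⁻ t in Set.Ioo 0 R, ENNReal.ofReal (|t| ^ u)) + 0 := by
        refine add_le_add (lintegral_union_le _ _ _) (le_of_eq ?_)
        exact setLIntegral_measure_zero _ _ (by simp)
    _ = _ := by
        rw [hpos, hneg, add_zero, ← ENNReal.ofReal_add (by positivity) (by positivity)]
        congr 1
        ring

lemma holder_ball {p q δ R : ℝ} (hp1 : 1 < p) (hq : 0 < q) (hδ : δ = 1 - 1 / p - 1 / q)
    (hR : 0 < R) {f : ℝ → ℂ} (hfm : Measurable f)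
    (hf : ∫⁻ x, ENNReal.ofReal (‖f x‖ ^ p) = 1) :
    ∫⁻ x in Set.Ioo (-R) R, ENNReal.ofReal (‖f x‖ * |x| ^ (-δ)) ≤
      ENNReal.ofReal ((2 / (-(δ * (p / (p - 1))) + 1)) ^ (1 - 1 / p) * R ^ (1 / q)) := by
  set s := p / (p - 1) with hs
  have hp1' : 0 < p - 1 := by linarith
  have hp0 : 0 < p := by linarith
  have hs0 : 0 < s := by positivity
  have hs1 : 1 / s = 1 - 1 / p := by rw [hs]; field_simp
  have hδs : -(δ * s) + 1 = s * (1 / q) := by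
    have : δ = 1 / s - 1 / q := by rw [hs1, hδ]
    rw [this]; field_simp; ring
  have hpos : 0 < -(δ * s) + 1 := by rw [hδs]; positivity
  have hconj : p.HolderConjugate s := by
    rw [Real.holderConjugate_iff]
    refine ⟨hp1, ?_⟩
    rw [hs]; field_simp; ring
  have H := ENNReal.lintegral_mul_le_Lp_mul_Lq (volume.restrict (Set.Ioo (-R) R)) hconj
    (f := fun x => ENNReal.ofReal ‖f x‖) (g := fun x => ENNReal.ofReal (|x| ^ (-δ)))
    (by fun_prop) (by fun_prop)
  have e1 : ∫⁻ x in Set.Ioo (-R) R, ENNReal.ofReal (‖f x‖) ^ p ≤ 1 := by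
    rw [← hf]
    refine (setLIntegral_le_lintegral _ _).trans (le_of_eq ?_)
    congr with x
    rw [ENNReal.ofReal_rpow_of_nonneg (norm_nonneg _) hp0.le]
  have e2 : ∫⁻ x in Set.Ioo (-R) R, ENNReal.ofReal (|x| ^ (-δ)) ^ s ≤
      ENNReal.ofReal (2 / (-(δ * s) + 1) * R ^ (-(δ * s) + 1)) := by
    refine le_trans (le_of_eq ?_) (lint_ball (by linarith) hR)
    congr with x
    rw [ENNReal.ofReal_rpow_of_nonneg (by positivity) hs0.le, ← Real.rpow_mul (abs_nonneg _)]
    congr 2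
    ring
  calc _ = ∫⁻ x in Set.Ioo (-R) R, ((fun x => ENNReal.ofReal ‖f x‖) *
          (fun x => ENNReal.ofReal (|x| ^ (-δ)))) x := by
        congr with x
        simp [ENNReal.ofReal_mul]
    _ ≤ _ := H
    _ ≤ 1 ^ (1 / p) * (ENNReal.ofReal (2 / (-(δ * s) + 1) * R ^ (-(δ * s) + 1))) ^ (1 / s) := by
        gcongr
    _ = _ := by
        rw [ENNReal.one_rpow, one_mul, ENNReal.ofReal_rpow_of_nonneg (by positivity) (by positivity),
          Real.mul_rpow (by positivity) (by positivity), ← Real.rpow_mul hR.le, hs1]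
        congr 3
        rw [hδs, ← hs1]; field_simp

lemma L1_bound {p q δ : ℝ} (hp1 : 1 < p) (hp2 : p ≤ 2) (hq1 : 2 < q)
    (hδ : δ = 1 - 1 / p - 1 / q) (hδ0 : 0 ≤ δ) :
    ∃ M : ℝ, 0 < M ∧ ∀ f : ℝ → ℂ, Measurable f → ∫⁻ x, ENNReal.ofReal (‖f x‖ ^ p) = 1 →
      ∀ t : ℝ, 0 < t →
      ∫⁻ x in {x | M * |x| ^ (2 * δ) ≤ ‖f x‖ ^ (2 - p) * t ^ (q - 2)},
        ENNReal.ofReal (‖f x‖ * |x| ^ (-δ)) ≤ ENNReal.ofReal (t / 2) := by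
  set K := (2 / (-(δ * (p / (p - 1))) + 1)) ^ (1 - 1 / p) with hK
  have hp1' : 0 < p - 1 := by linarith
  have hp0 : 0 < p := by linarith
  have hq0 : 0 < q := by linarith
  have hK0 : 0 < K := by
    apply Real.rpow_pos_of_pos
    apply div_pos two_pos
    have : -(δ * (p / (p - 1))) + 1 = p / (p - 1) * (1 / q) := by rw [hδ]; field_simp; ring
    rw [this]; positivity
  set r := (4 * K) ^ (-q) with hr
  have hr0 : 0 < r := by positivity
  have hrq : r ^ (1 / q) = (4 * K)⁻¹ := by
    rw [hr, ← Real.rpow_mul (by positivity)]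
    rw [show -q * (1 / q) = -1 by field_simp, Real.rpow_neg_one]
  set M := (2 * (4 : ℝ) ^ (2 - p) * r ^ (-(δ * p))) ^ (1 / (p - 1)) with hM
  have hM0 : 0 < M := by positivity
  have hMp : (4 : ℝ) ^ (2 - p) < M ^ (p - 1) * r ^ (δ * p) := by
    rw [hM, ← Real.rpow_mul (by positivity), show 1 / (p - 1) * (p - 1) = 1 by field_simp,
      Real.rpow_one, mul_assoc, ← Real.rpow_add hr0]
    have : (0 : ℝ) < 4 ^ (2 - p) := by positivity
    simp only [neg_add_cancel, Real.rpow_zero]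
    linarith
  have hδ' : δ * (p * q) = p * q - q - p := by rw [hδ]; field_simp
  refine ⟨M, hM0, fun f hfm hf t ht => ?_⟩
  set A := {x | M * |x| ^ (2 * δ) ≤ ‖f x‖ ^ (2 - p) * t ^ (q - 2)} with hA
  have hAm : MeasurableSet A := measurableSet_le (by fun_prop) (by fun_prop)
  set R := r * t ^ q with hR
  have hR0 : 0 < R := by positivity
  have hRq : K * R ^ (1 / q) = t / 4 := by
    rw [hR, Real.mul_rpow hr0.le (by positivity), hrq, ← Real.rpow_mul ht.le,
      show q * (1 / q) = 1 by field_simp, Real.rpow_one]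
    field_simp
  have hsub : A ⊆ Set.Ioo (-R) R ∪ (A \ Set.Ioo (-R) R) := by
    intro x hx
    by_cases h : x ∈ Set.Ioo (-R) R
    · exact Or.inl h
    · exact Or.inr ⟨hx, h⟩
  have h1 := holder_ball hp1 hq0 hδ hR0 hfm hf
  rw [← hK, hRq] at h1
  have h2 : ∫⁻ x in A \ Set.Ioo (-R) R, ENNReal.ofReal (‖f x‖ * |x| ^ (-δ)) ≤
      ENNReal.ofReal (t / 4) := by
    calc _ ≤ ∫⁻ x in A \ Set.Ioo (-R) R, ENNReal.ofReal (t / 4) * ENNReal.ofReal (‖f x‖ ^ p) := by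
          refine setLIntegral_mono' (hAm.diff measurableSet_Ioo) fun x hx => ?_
          rw [← ENNReal.ofReal_mul (by positivity)]
          apply ENNReal.ofReal_le_ofReal
          have hxR : R ≤ |x| := by
            by_contra! h
            exact hx.2 (abs_lt.1 h)
          rcases (norm_nonneg (f x)).eq_or_lt with h0 | h0
          · rw [← h0, zero_mul]; positivity
          · exact ptw hp1 hp2 hδ' hδ0 hM0 hr0 ht h0 (hR0.trans_le hxR) hMp hx.1 hxR
      _ ≤ ∫⁻ x, ENNReal.ofReal (t / 4) * ENNReal.ofReal (‖f x‖ ^ p) :=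
          setLIntegral_le_lintegral _ _
      _ = _ := by
          rw [lintegral_const_mul _ (by fun_prop), hf, mul_one]
  calc _ ≤ _ := lintegral_mono_set hsub
    _ ≤ _ := lintegral_union_le _ _ _
    _ ≤ ENNReal.ofReal (t / 4) + ENNReal.ofReal (t / 4) := add_le_add h1 h2
    _ = _ := by
      rw [← ENNReal.ofReal_add (by positivity) (by positivity)]
      congr 1; ring

lemma core_two {f : ℝ → ℂ} (hf : ∫⁻ x, ENNReal.ofReal (‖f x‖ ^ (2 : ℝ)) = 1)
    (hi : Integrable f) :
    ∫⁻ ξ, ENNReal.ofReal (‖FTr f ξ‖ ^ (2 : ℝ)) ≤ ENNReal.ofReal (2 * Real.pi) := by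
  have e : ∀ z : ℂ, ENNReal.ofReal (‖z‖ ^ (2 : ℝ)) = ‖z‖ₑ ^ 2 := fun z => by
    rw [Real.rpow_two, ENNReal.ofReal_pow (norm_nonneg _), ofReal_norm]
  simp only [e] at hf ⊢
  have := FTr_L2 hi
  rwa [hf, mul_one] at this

lemma meas_bound {g : ℝ → ℂ} (hg : Integrable g) {A : Set ℝ} (hA : MeasurableSet A) {t : ℝ}
    (ht : 0 < t) (h1 : ∫⁻ x in A, ‖g x‖ₑ ≤ ENNReal.ofReal (t / 2)) :
    volume {ξ | t < ‖FTr g ξ‖} ≤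
      ENNReal.ofReal (8 * Real.pi * t ^ (-2 : ℝ)) * ∫⁻ x, Aᶜ.indicator (fun x => ‖g x‖ₑ ^ 2) x := by
  set g1 := A.indicator g with hg1
  set g0 := Aᶜ.indicator g with hg0
  have i1 : Integrable g1 := hg.indicator hA
  have i0 : Integrable g0 := hg.indicator hA.compl
  have hsum : g0 + g1 = g := by
    rw [hg0, hg1, add_comm]; exact Set.indicator_self_add_compl A g
  have hle : ∀ ξ, ‖FTr g1 ξ‖ ≤ t / 2 := by
    intro ξ
    have h2 := FTr_norm_le g1 ξ
    have h3 : ∫⁻ x, ‖g1 x‖ₑ = ∫⁻ x in A, ‖g x‖ₑ := by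
      rw [← lintegral_indicator hA]
      congr with x
      rw [hg1, enorm_indicator_eq_indicator_enorm]
    rw [h3] at h2
    exact (ENNReal.ofReal_le_ofReal_iff (by positivity)).1 (h2.trans h1)
  have hsub : {ξ | t < ‖FTr g ξ‖} ⊆ {ξ | ENNReal.ofReal (t / 2) ^ 2 ≤ ‖FTr g0 ξ‖ₑ ^ 2} := by
    intro ξ hξ
    have hξ' : t < ‖FTr g ξ‖ := hξ
    rw [← hsum, FTr_add i0 i1] at hξ'
    have h4 := norm_add_le (FTr g0 ξ) (FTr g1 ξ)
    have h5 := hle ξ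
    have : t / 2 ≤ ‖FTr g0 ξ‖ := by linarith
    show ENNReal.ofReal (t / 2) ^ 2 ≤ ‖FTr g0 ξ‖ₑ ^ 2
    rw [← ofReal_norm]
    gcongr
  have hm : Measurable fun ξ => ‖FTr g0 ξ‖ₑ ^ 2 := by
    have := (FTr_continuous i0).measurable
    fun_prop
  have mk := mul_meas_ge_le_lintegral (μ := volume) hm (ENNReal.ofReal (t / 2) ^ 2)
  have l2 := FTr_L2 i0
  have h6 : ∫⁻ x, ‖g0 x‖ₑ ^ 2 = ∫⁻ x, Aᶜ.indicator (fun x => ‖g x‖ₑ ^ 2) x := by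
    congr with x
    rw [hg0]
    by_cases hx : x ∈ Aᶜ
    · simp [Set.indicator_of_mem hx]
    · simp [Set.indicator_of_notMem hx]
  rw [h6] at l2
  set L := ∫⁻ x, Aᶜ.indicator (fun x => ‖g x‖ₑ ^ 2) x
  have h7 : ENNReal.ofReal (t / 2) ^ 2 * volume {ξ | t < ‖FTr g ξ‖} ≤
      ENNReal.ofReal (2 * Real.pi) * L :=
    le_trans (by gcongr) (mk.trans l2)
  have h8 : ENNReal.ofReal (4 * t ^ (-2 : ℝ)) * ENNReal.ofReal (t / 2) ^ 2 = 1 := by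
    rw [← ENNReal.ofReal_pow (by positivity), ← ENNReal.ofReal_mul (by positivity),
      Real.rpow_neg ht.le, Real.rpow_two]
    rw [show 4 * (t ^ 2)⁻¹ * (t / 2) ^ 2 = 1 by field_simp; norm_num]
    simp
  calc volume {ξ | t < ‖FTr g ξ‖}
      = ENNReal.ofReal (4 * t ^ (-2 : ℝ)) * (ENNReal.ofReal (t / 2) ^ 2 *
        volume {ξ | t < ‖FTr g ξ‖}) := by rw [← mul_assoc, h8, one_mul]
    _ ≤ ENNReal.ofReal (4 * t ^ (-2 : ℝ)) * (ENNReal.ofReal (2 * Real.pi) * L) := by gcongr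
    _ = _ := by
      rw [← mul_assoc, ← ENNReal.ofReal_mul (by positivity)]
      congr 2
      ring

lemma core {p q δ : ℝ} (hp1 : 1 < p) (hp2 : p ≤ 2) (hq1 : 2 < q)
    (hδ : δ = 1 - 1 / p - 1 / q) (hδ0 : 0 ≤ δ) :
    ∃ C : ℝ, ∀ f : ℝ → ℂ, Measurable f → ∫⁻ x, ENNReal.ofReal (‖f x‖ ^ p) = 1 →
      Integrable (fun x => f x * ((|x| ^ (-δ) : ℝ) : ℂ)) →
      ∫⁻ ξ, ENNReal.ofReal (‖FTr (fun x => f x * ((|x| ^ (-δ) : ℝ) : ℂ)) ξ‖ ^ q) ≤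
        ENNReal.ofReal C := by
  obtain ⟨M, hM0, hM⟩ := L1_bound hp1 hp2 hq1 hδ hδ0
  have hq0 : 0 < q := by linarith
  have hq2 : 0 < q - 2 := by linarith
  refine ⟨q * (8 * Real.pi * M / (q - 2)), fun f hfm hf hgi => ?_⟩
  set g : ℝ → ℂ := fun x => f x * ((|x| ^ (-δ) : ℝ) : ℂ) with hg
  have hgn : ∀ x, ‖g x‖ = ‖f x‖ * |x| ^ (-δ) := fun x => by
    rw [hg]
    simp only [norm_mul, Complex.norm_real, Real.norm_eq_abs]
    rw [abs_of_nonneg (by positivity : 0 ≤ |x| ^ (-δ))]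
  have hgm : Measurable g := by
    rw [hg]; fun_prop
  set S : Set (ℝ × ℝ) :=
    {z | M * |z.2| ^ (2 * δ) ≤ ‖f z.2‖ ^ (2 - p) * z.1 ^ (q - 2)}ᶜ with hS
  have hSm : MeasurableSet S := by
    apply MeasurableSet.compl
    exact measurableSet_le (by fun_prop) (by fun_prop)
  set H : ℝ × ℝ → ℝ≥0∞ := S.indicator (fun z => ENNReal.ofReal (8 * Real.pi) *
    (‖g z.2‖ₑ ^ 2 * ENNReal.ofReal (z.1 ^ (q - 3)))) with hH
  have hHm : Measurable H := by
    apply Measurable.indicator _ hSm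
    fun_prop
  have step1 : ∀ t ∈ Set.Ioi (0 : ℝ), volume {ξ | t < ‖FTr g ξ‖} * ENNReal.ofReal (t ^ (q - 1)) ≤
      ∫⁻ x, H (t, x) := by
    intro t ht
    have ht : 0 < t := ht
    set A := {x | M * |x| ^ (2 * δ) ≤ ‖f x‖ ^ (2 - p) * t ^ (q - 2)} with hA
    have hAm : MeasurableSet A := measurableSet_le (by fun_prop) (by fun_prop)
    have h1 : ∫⁻ x in A, ‖g x‖ₑ ≤ ENNReal.ofReal (t / 2) := by
      have := hM f hfm hf t ht
      simp_rw [← hgn, ofReal_norm] at this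
      exact this
    have h2 := meas_bound hgi hAm ht h1
    calc _ ≤ (ENNReal.ofReal (8 * Real.pi * t ^ (-2 : ℝ)) *
          ∫⁻ x, Aᶜ.indicator (fun x => ‖g x‖ₑ ^ 2) x) * ENNReal.ofReal (t ^ (q - 1)) := by gcongr
      _ = (ENNReal.ofReal (8 * Real.pi) * ENNReal.ofReal (t ^ (q - 3))) *
          ∫⁻ x, Aᶜ.indicator (fun x => ‖g x‖ₑ ^ 2) x := by
          rw [mul_right_comm, ← ENNReal.ofReal_mul (by positivity),
            ← ENNReal.ofReal_mul (by positivity), mul_assoc (8 * Real.pi), ← Real.rpow_add ht]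
          congr 4
          ring
      _ = ∫⁻ x, H (t, x) := by
          rw [← lintegral_const_mul _ (by
            apply Measurable.indicator _ hAm.compl
            fun_prop)]
          congr with x
          by_cases hx : x ∈ Aᶜ
          · have hx' : (t, x) ∈ S := hx
            rw [hH, Set.indicator_of_mem hx, Set.indicator_of_mem hx']
            ring
          · have hx' : (t, x) ∉ S := hx
            rw [hH, Set.indicator_of_notMem hx, Set.indicator_of_notMem hx', mul_zero]
  have step2 : ∀ x : ℝ, x ≠ 0 → ∫⁻ t in Set.Ioi (0 : ℝ), H (t, x) ≤
      ENNReal.ofReal (8 * Real.pi * M / (q - 2)) * ENNReal.ofReal (‖f x‖ ^ p) := by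
    intro x hx
    have hx0 : 0 < |x| := abs_pos.2 hx
    rcases (norm_nonneg (f x)).eq_or_lt with h0 | h0
    · have : ∀ t, H (t, x) = 0 := by
        intro t
        have hgx : g x = 0 := by rw [← norm_eq_zero, hgn, ← h0, zero_mul]
        rw [hH, Set.indicator_apply]
        simp [hgx]
      simp [this]
    set B := M * |x| ^ (2 * δ) * ‖f x‖ ^ (p - 2) with hB
    have hB0 : 0 < B := by positivity
    set b := B ^ (1 / (q - 2)) with hb
    have hle : ∀ t ∈ Set.Ioi (0 : ℝ), H (t, x) ≤ (Set.Iio b).indicator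
        (fun t => (ENNReal.ofReal (8 * Real.pi) * ‖g x‖ₑ ^ 2) * ENNReal.ofReal (t ^ (q - 3))) t := by
      intro t ht
      have ht : 0 < t := ht
      by_cases hxS : (t, x) ∈ S
      · have h1 : ‖f x‖ ^ (2 - p) * t ^ (q - 2) < M * |x| ^ (2 * δ) := not_le.1 hxS
        have h2 : t ^ (q - 2) < B := by
          have h3 := mul_lt_mul_of_pos_right h1 (by positivity : 0 < ‖f x‖ ^ (p - 2))
          have h4 : ‖f x‖ ^ (2 - p) * ‖f x‖ ^ (p - 2) = 1 := by
            rw [← Real.rpow_add h0]; simp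
          calc t ^ (q - 2) = ‖f x‖ ^ (2 - p) * ‖f x‖ ^ (p - 2) * t ^ (q - 2) := by
                rw [h4, one_mul]
            _ = ‖f x‖ ^ (2 - p) * t ^ (q - 2) * ‖f x‖ ^ (p - 2) := by ring
            _ < _ := h3
        have h5 : t < b := by
          have := Real.rpow_lt_rpow (by positivity) h2 (by positivity : 0 < 1 / (q - 2))
          rwa [← Real.rpow_mul ht.le, show (q - 2) * (1 / (q - 2)) = 1 by field_simp,
            Real.rpow_one] at this
        rw [hH, Set.indicator_of_mem hxS, Set.indicator_of_mem (Set.mem_Iio.2 h5), mul_assoc]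
      · rw [hH, Set.indicator_of_notMem hxS]; exact zero_le
    calc _ ≤ _ := setLIntegral_mono' measurableSet_Ioi hle
      _ = (ENNReal.ofReal (8 * Real.pi) * ‖g x‖ₑ ^ 2) *
          ∫⁻ t in Set.Ioo 0 b, ENNReal.ofReal (t ^ (q - 3)) := by
          rw [setLIntegral_indicator measurableSet_Iio, Set.inter_comm, Set.Ioi_inter_Iio,
            lintegral_const_mul _ (by fun_prop)]
      _ = (ENNReal.ofReal (8 * Real.pi) * ‖g x‖ₑ ^ 2) * ENNReal.ofReal (B / (q - 2)) := by
          rw [lint_pow (by linarith) (by positivity), show q - 3 + 1 = q - 2 by ring, hb,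
            ← Real.rpow_mul hB0.le, show 1 / (q - 2) * (q - 2) = 1 by field_simp, Real.rpow_one]
      _ = _ := by
          rw [← ofReal_norm, hgn, ← ENNReal.ofReal_pow (by positivity),
            ← ENNReal.ofReal_mul (by positivity), ← ENNReal.ofReal_mul (by positivity),
            ← ENNReal.ofReal_mul (by positivity)]
          congr 1
          have e1 : (|x| ^ (-δ)) ^ 2 * |x| ^ (2 * δ) = 1 := by
            rw [← Real.rpow_two, ← Real.rpow_mul hx0.le, ← Real.rpow_add hx0]
            rw [show -δ * 2 + 2 * δ = 0 by ring, Real.rpow_zero]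
          have e2 : ‖f x‖ ^ 2 * ‖f x‖ ^ (p - 2) = ‖f x‖ ^ p := by
            rw [← Real.rpow_two, ← Real.rpow_add h0]
            congr 1; ring
          calc 8 * Real.pi * (‖f x‖ * |x| ^ (-δ)) ^ 2 * (B / (q - 2))
              = 8 * Real.pi * M / (q - 2) * (‖f x‖ ^ 2 * ‖f x‖ ^ (p - 2)) *
                ((|x| ^ (-δ)) ^ 2 * |x| ^ (2 * δ)) := by rw [hB]; ring
            _ = _ := by rw [e1, e2, mul_one]
  rw [lintegral_rpow_eq_lintegral_meas_lt_mul volume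
    (Filter.Eventually.of_forall fun ξ => norm_nonneg _)
    (FTr_continuous hgi).norm.measurable.aemeasurable hq0, ENNReal.ofReal_mul hq0.le]
  gcongr
  calc _ ≤ ∫⁻ t in Set.Ioi (0 : ℝ), ∫⁻ x, H (t, x) := setLIntegral_mono' measurableSet_Ioi step1
    _ = ∫⁻ x, ∫⁻ t in Set.Ioi (0 : ℝ), H (t, x) :=
        lintegral_lintegral_swap (f := fun t x => H (t, x)) hHm.aemeasurable
    _ ≤ ∫⁻ x, ENNReal.ofReal (8 * Real.pi * M / (q - 2)) * ENNReal.ofReal (‖f x‖ ^ p) := by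
        apply lintegral_mono_ae
        filter_upwards [Measure.ae_ne volume (0 : ℝ)] with x hx using step2 x hx
    _ = _ := by rw [lintegral_const_mul _ (by fun_prop), hf, mul_one]

lemma integrable_weight {δ : ℝ} (hδ0 : 0 ≤ δ) (hδ1 : δ < 1) (f : SchwartzMap ℝ ℂ) :
    Integrable (fun x => f x * ((|x| ^ (-δ) : ℝ) : ℂ)) := by
  have hw : Integrable ((Set.Ioo (-1 : ℝ) 1).indicator fun x : ℝ => |x| ^ (-δ)) := by
    rw [integrable_indicator_iff measurableSet_Ioo]
    refine ⟨(by fun_prop : Measurable fun x : ℝ => |x| ^ (-δ)).aestronglyMeasurable, ?_⟩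
    rw [hasFiniteIntegral_iff_ofReal (Filter.Eventually.of_forall fun x => by positivity)]
    exact (lint_ball (by linarith) one_pos).trans_lt ENNReal.ofReal_lt_top
  obtain ⟨D, hD⟩ : ∃ D : ℝ, ∀ x, ‖f x‖ ≤ D := by
    obtain ⟨D, hD⟩ := f.decay 0 0
    exact ⟨D, fun x => by simpa using hD.2 x⟩
  have hfm : Measurable f := f.continuous.measurable
  refine Integrable.mono' (f.integrable.norm.add (hw.const_mul D))
    (by fun_prop : Measurable _).aestronglyMeasurable (Filter.Eventually.of_forall fun x => ?_)
  have hD0 : 0 ≤ D := (norm_nonneg _).trans (hD x)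
  have hpos : 0 ≤ |x| ^ (-δ) := by positivity
  simp only [norm_mul, Complex.norm_real, Real.norm_eq_abs, abs_of_nonneg hpos, Pi.add_apply]
  by_cases hx : x ∈ Set.Ioo (-1 : ℝ) 1
  · rw [Set.indicator_of_mem hx]
    have := mul_le_mul_of_nonneg_right (hD x) hpos
    linarith [norm_nonneg (f x)]
  · rw [Set.indicator_of_notMem hx]
    have h1 : 1 ≤ |x| := by
      by_contra! h
      exact hx (abs_lt.1 h)
    have h2 : |x| ^ (-δ) ≤ 1 := Real.rpow_le_one_of_one_le_of_nonpos h1 (by linarith)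
    have := mul_le_mul_of_nonneg_left h2 (norm_nonneg (f x))
    linarith

lemma core_all {p q δ : ℝ} (hp1 : 1 < p) (hp2 : p ≤ 2) (hq1 : 2 ≤ q)
    (hδ : δ = 1 - 1 / p - 1 / q) (hδ0 : 0 ≤ δ) :
    ∃ C : ℝ, ∀ f : ℝ → ℂ, Measurable f → ∫⁻ x, ENNReal.ofReal (‖f x‖ ^ p) = 1 →
      Integrable (fun x => f x * ((|x| ^ (-δ) : ℝ) : ℂ)) →
      ∫⁻ ξ, ENNReal.ofReal (‖FTr (fun x => f x * ((|x| ^ (-δ) : ℝ) : ℂ)) ξ‖ ^ q) ≤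
        ENNReal.ofReal C := by
  rcases hq1.eq_or_lt with h | h
  · subst h
    have hp : p = 2 := by
      apply le_antisymm hp2
      by_contra! hlt
      have : 1 / 2 < 1 / p := one_div_lt_one_div_of_lt (by linarith) hlt
      linarith
    subst hp
    have hδ' : δ = 0 := by rw [hδ]; norm_num
    subst hδ'
    refine ⟨2 * Real.pi, fun f _ hf hi => ?_⟩
    simp only [neg_zero, Real.rpow_zero, Complex.ofReal_one, mul_one] at hi ⊢
    exact core_two hf hi
  · exact core hp1 hp2 h hδ hδ0

lemma eLpNorm_ofReal_eq {r : ℝ} (hr : 0 < r) (h : ℝ → ℂ) :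
    eLpNorm h (ENNReal.ofReal r) volume = (∫⁻ x, ENNReal.ofReal (‖h x‖ ^ r)) ^ (1 / r) := by
  rw [eLpNorm_eq_lintegral_rpow_enorm_toReal (by simpa using hr) ENNReal.ofReal_ne_top,
    ENNReal.toReal_ofReal hr.le]
  congr with x
  rw [← ofReal_norm, ENNReal.ofReal_rpow_of_nonneg (norm_nonneg _) hr.le]

/-- **Lemma (weighted Hausdorff–Young inequality).** Let `1 < p ≤ 2 ≤ q < ∞` and
`δ = 1 − 1/p − 1/q` with `0 ≤ δ < 1`. Then there is `C = C(p,q) < ∞` with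
`‖ĝ‖_{L^q(ℝ)} ≤ C ‖f‖_{L^p(ℝ)}` for every Schwartz `f : ℝ → ℂ`, where
`g(x) = f(x) |x|^{−δ}` and `ĝ(ξ) = ∫ g(x) e^{−iξx} dx`. -/
theorem stmt12 (p q : ℝ) (hp1 : 1 < p) (hp2 : p ≤ 2) (hq1 : 2 ≤ q)
    (δ : ℝ) (hδ : δ = 1 - 1 / p - 1 / q) (hδ0 : 0 ≤ δ) (hδ1 : δ < 1) :
    ∃ C : ℝ, ∀ f : SchwartzMap ℝ ℂ,
      eLpNorm
        (fun ξ : ℝ => ∫ x : ℝ,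
          (f x * ((|x| ^ (-δ) : ℝ) : ℂ)) * Complex.exp (-(Complex.I * ((ξ * x : ℝ) : ℂ))))
        (ENNReal.ofReal q) volume ≤
      ENNReal.ofReal C * eLpNorm (fun x => f x) (ENNReal.ofReal p) volume := by
  have hp0 : 0 < p := by linarith
  have hq0 : 0 < q := by linarith
  obtain ⟨C, hC⟩ := core_all hp1 hp2 hq1 hδ hδ0
  refine ⟨(max C 0) ^ (1 / q), fun f => ?_⟩
  have hint := integrable_weight hδ0 hδ1 f
  set g : ℝ → ℂ := fun x => f x * ((|x| ^ (-δ) : ℝ) : ℂ) with hg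
  change eLpNorm (FTr g) (ENNReal.ofReal q) volume ≤ _
  have hmem : MemLp f (ENNReal.ofReal p) volume := f.memLp _ _
  set N := eLpNorm (fun x => f x) (ENNReal.ofReal p) volume with hN
  have hNtop : N ≠ ⊤ := hmem.2.ne
  by_cases hN0 : N = 0
  · have hf0 : (fun x => f x) =ᵐ[volume] 0 :=
      (eLpNorm_eq_zero_iff hmem.1 (by simpa using hp0)).1 hN0
    have hz : FTr g = 0 := by
      funext ξ
      unfold FTr
      rw [Pi.zero_apply]
      apply integral_eq_zero_of_ae
      filter_upwards [hf0] with x hx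
      have hx' : f x = 0 := hx
      simp [hg, hx']
    rw [hz, eLpNorm_zero]
    exact zero_le
  set n : ℝ := N.toReal with hn
  have hn0 : 0 < n := ENNReal.toReal_pos hN0 hNtop
  have hnN : ENNReal.ofReal n = N := ENNReal.ofReal_toReal hNtop
  have hnc : (n : ℂ) ≠ 0 := by exact_mod_cast hn0.ne'
  set F : ℝ → ℂ := fun x => (n : ℂ)⁻¹ * f x with hF
  have hfm : Measurable f := f.continuous.measurable
  have hFm : Measurable F := by rw [hF]; fun_prop
  have hF1 : ∫⁻ x, ENNReal.ofReal (‖F x‖ ^ p) = 1 := by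
    have h1 : eLpNorm F (ENNReal.ofReal p) volume = 1 := by
      have : F = (n : ℂ)⁻¹ • (fun x => f x) := rfl
      rw [this, eLpNorm_const_smul, ← hN, ← hnN, ← ofReal_norm, ← ENNReal.ofReal_mul (by positivity)]
      rw [norm_inv, Complex.norm_real, Real.norm_eq_abs, abs_of_pos hn0, inv_mul_cancel₀ hn0.ne']
      simp
    rw [eLpNorm_ofReal_eq hp0] at h1
    have h2 := congrArg (· ^ p) h1
    simp only [ENNReal.one_rpow] at h2
    rwa [← ENNReal.rpow_mul, show 1 / p * p = 1 by field_simp, ENNReal.rpow_one] at h2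
  set G : ℝ → ℂ := fun x => F x * ((|x| ^ (-δ) : ℝ) : ℂ) with hG
  have hGg : G = fun x => (n : ℂ)⁻¹ * g x := by
    funext x; simp only [hG, hF, hg]; ring
  have hGi : Integrable G := by rw [hGg]; exact hint.const_mul _
  have hFT : FTr g = (n : ℂ) • FTr G := by
    funext ξ
    rw [Pi.smul_apply, smul_eq_mul]
    unfold FTr
    rw [← integral_const_mul]
    congr with x
    rw [hGg]
    field_simp
  have hb := hC F hFm hF1 hGi
  rw [hFT, eLpNorm_const_smul, ← hnN, mul_comm]
  have e1 : ‖(n : ℂ)‖ₑ = ENNReal.ofReal n := by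
    rw [← ofReal_norm, Complex.norm_real, Real.norm_eq_abs, abs_of_pos hn0]
  rw [e1]
  gcongr
  rw [eLpNorm_ofReal_eq hq0, ← ENNReal.ofReal_rpow_of_nonneg (le_max_right _ _) (by positivity)]
  gcongr
  exact hb.trans (ENNReal.ofReal_le_ofReal (le_max_left _ _))
end
end

section
/- Let ℓ ∈ (0,∞), 1 < p ≤ q < ∞, a ≥ 0, and 0 < b < 1, and suppose 1/p' + 1/q ≥ a + b, where p' = p/(p−1). Then there exists a constant C < ∞ (depending on ℓ, p, q, a, b) such that for every measurable f : (0,ℓ] → [0,∞], ( ∫_0^ℓ ( x^{−a} ∫_0^x (x−y)^{−b} f(y) dy )^q dx )^{1/q} ≤ C ( ∫_0^ℓ f(y)^p dy )^{1/p}. -/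
open MeasureTheory Set
open scoped ENNReal

noncomputable section

lemma lint_rpow_Ioo {α c : ℝ} (hα : -1 < α) (hc : 0 < c) :
    ∫⁻ t in Ioo 0 c, ENNReal.ofReal (t ^ α) = ENNReal.ofReal (c ^ (α + 1) / (α + 1)) := by
  have h0 : α + 1 ≠ 0 := by linarith
  have hi := (intervalIntegral.intervalIntegrable_rpow' (a := 0) (b := c) hα)
  rw [intervalIntegrable_iff_integrableOn_Ioc_of_le hc.le] at hi
  rw [restrict_Ioo_eq_restrict_Ioc, ← ofReal_integral_eq_lintegral_ofReal hi,
    ← intervalIntegral.integral_of_le hc.le, integral_rpow (Or.inl hα), Real.zero_rpow h0, sub_zero]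
  filter_upwards [ae_restrict_mem measurableSet_Ioc] with t ht
  exact Real.rpow_nonneg ht.1.le _

lemma lint_rpow_Ioi {α c : ℝ} (hα : α < -1) (hc : 0 < c) :
    ∫⁻ t in Ioi c, ENNReal.ofReal (t ^ α) = ENNReal.ofReal (-c ^ (α + 1) / (α + 1)) := by
  rw [← ofReal_integral_eq_lintegral_ofReal (integrableOn_Ioi_rpow_of_lt hα hc),
    integral_Ioi_rpow_of_lt hα hc]
  filter_upwards [ae_restrict_mem measurableSet_Ioi] with t ht
  exact Real.rpow_nonneg (hc.trans ht).le _

/-- left averages -/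
def lphi (h : ℝ → ℝ≥0∞) (x t : ℝ) : ℝ≥0∞ := ∫⁻ y in Ioc (x - t) x, h y

lemma lphi_eq (h : ℝ → ℝ≥0∞) (x t : ℝ) :
    lphi h x t = ∫⁻ y in Iic x, (if x - t < y then h y else 0) := by
  have : (fun y => if x - t < y then h y else 0) = (Ioi (x - t)).indicator h := by
    ext y; simp [indicator, mem_Ioi]
  rw [this, lintegral_indicator measurableSet_Ioi, Measure.restrict_restrict measurableSet_Ioi,
    Ioi_inter_Iic, lphi]

lemma kernel_le {b : ℝ} (hb : 0 < b) (h : ℝ → ℝ≥0∞) (hh : Measurable h) (x : ℝ) :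
    ∫⁻ y in Iic x, ENNReal.ofReal ((x - y) ^ (-b)) * h y ≤
      ENNReal.ofReal b * ∫⁻ t in Ioi 0, ENNReal.ofReal (t ^ (-b - 1)) * lphi h x t := by
  have e1 : ∀ t, ENNReal.ofReal (t ^ (-b - 1)) * lphi h x t =
      ∫⁻ y in Iic x, ENNReal.ofReal (t ^ (-b - 1)) * (if x - t < y then h y else 0) := by
    intro t
    rw [lphi_eq, lintegral_const_mul]
    exact Measurable.ite (measurableSet_lt measurable_const measurable_id) hh measurable_const
  simp_rw [e1]
  rw [lintegral_lintegral_swap, ← lintegral_const_mul']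
  · apply setLIntegral_mono_ae' measurableSet_Iic
    refine Filter.Eventually.of_forall fun y hy => ?_
    have hy' : y ≤ x := hy
    rcases hy'.eq_or_lt with rfl | hlt
    · simp [Real.zero_rpow (neg_ne_zero.2 hb.ne')]
    have hd : 0 < x - y := by linarith
    have : ∫⁻ t in Ioi (x - y), ENNReal.ofReal (t ^ (-b - 1)) * h y ≤
        ∫⁻ t in Ioi 0, ENNReal.ofReal (t ^ (-b - 1)) * (if x - t < y then h y else 0) := by
      refine le_trans (le_of_eq ?_) (lintegral_mono_set (Ioi_subset_Ioi hd.le))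
      refine setLIntegral_congr_fun measurableSet_Ioi fun t ht => ?_
      have ht' : x - y < t := ht
      rw [if_pos (by linarith)]
    refine le_trans ?_ (mul_le_mul_right this _)
    rw [lintegral_mul_const _ (by fun_prop), lint_rpow_Ioi (by linarith) hd, ← mul_assoc,
      ← ENNReal.ofReal_mul hb.le]
    apply le_of_eq
    congr 2
    have : -b - 1 + 1 = -b := by ring
    rw [this]; field_simp
  · exact ENNReal.ofReal_ne_top
  · apply Measurable.aemeasurable
    apply Measurable.mul (by fun_prop)
    exact Measurable.ite (measurableSet_lt (by fun_prop) (by fun_prop)) (by fun_prop)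
      measurable_const

/-- the splitting estimate -/
lemma split_est {b θ r : ℝ} (hb1 : b < 1) (hθ : θ < b) (hr : 0 < r)
    (Φ : ℝ → ℝ≥0∞) (A B : ℝ≥0∞) (h1 : ∀ t, 0 < t → Φ t ≤ ENNReal.ofReal t * A)
    (h2 : ∀ t, 0 < t → Φ t ≤ ENNReal.ofReal (t ^ θ) * B) :
    ∫⁻ t in Ioi 0, ENNReal.ofReal (t ^ (-b - 1)) * Φ t ≤
      ENNReal.ofReal (1 / (1 - b)) * (ENNReal.ofReal (r ^ (1 - b)) * A) +
      ENNReal.ofReal (1 / (b - θ)) * (ENNReal.ofReal (r ^ (θ - b)) * B) := by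
  have hU : Ioi (0 : ℝ) = Ioc 0 r ∪ Ioi r := (Ioc_union_Ioi_eq_Ioi hr.le).symm
  rw [hU]
  refine (lintegral_union_le _ _ _).trans (add_le_add ?_ ?_)
  · rw [← restrict_Ioo_eq_restrict_Ioc]
    have : ∫⁻ t in Ioo 0 r, ENNReal.ofReal (t ^ (-b - 1)) * Φ t ≤
        ∫⁻ t in Ioo 0 r, ENNReal.ofReal (t ^ (-b)) * A := by
      apply setLIntegral_mono_ae' measurableSet_Ioo
      refine Filter.Eventually.of_forall fun t ht => ?_
      refine (mul_le_mul_right (h1 t ht.1) _).trans ?_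
      rw [← mul_assoc, ← ENNReal.ofReal_mul (Real.rpow_nonneg ht.1.le _),
        ← Real.rpow_add_one ht.1.ne']
      apply le_of_eq; congr 3; ring
    refine this.trans ?_
    rw [lintegral_mul_const _ (by fun_prop), lint_rpow_Ioo (by linarith) hr, ← mul_assoc,
      ← ENNReal.ofReal_mul (by have : 0 < 1 - b := by linarith
                               positivity)]
    apply le_of_eq; congr 2
    rw [show -b + 1 = 1 - b by ring]; ring
  · have : ∫⁻ t in Ioi r, ENNReal.ofReal (t ^ (-b - 1)) * Φ t ≤
        ∫⁻ t in Ioi r, ENNReal.ofReal (t ^ (θ - b - 1)) * B := by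
      apply setLIntegral_mono_ae' measurableSet_Ioi
      refine Filter.Eventually.of_forall fun t ht => ?_
      have ht0 : 0 < t := hr.trans ht
      refine (mul_le_mul_right (h2 t ht0) _).trans ?_
      rw [← mul_assoc, ← ENNReal.ofReal_mul (Real.rpow_nonneg ht0.le _),
        ← Real.rpow_add ht0]
      apply le_of_eq; congr 3; ring
    refine this.trans ?_
    rw [lintegral_mul_const _ (by fun_prop), lint_rpow_Ioi (by linarith) hr, ← mul_assoc,
      ← ENNReal.ofReal_mul (by have : 0 < b - θ := by linarith
                               positivity)]
    apply le_of_eq; congr 2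
    rw [show θ - b - 1 + 1 = -(b - θ) by ring, show θ - b = -(b - θ) by ring, neg_div_neg_eq]; ring

/-- layer cake, upper -/
lemma cake_upper {p : ℝ} (hp : 1 < p) (c : ℝ≥0∞) :
    c ^ p ≤ ENNReal.ofReal p * ∫⁻ t in Ioi (0:ℝ),
      (if ENNReal.ofReal t < c then ENNReal.ofReal (t ^ (p - 1)) else 0) := by
  have key : ∀ d : ℝ, 0 < d → ENNReal.ofReal d ≤ c → (ENNReal.ofReal d) ^ p ≤
      ENNReal.ofReal p * ∫⁻ t in Ioi (0:ℝ),
      (if ENNReal.ofReal t < c then ENNReal.ofReal (t ^ (p - 1)) else 0) := by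
    intro d hd hdc
    have : ∫⁻ t in Ioo 0 d, ENNReal.ofReal (t ^ (p - 1)) ≤ ∫⁻ t in Ioi (0:ℝ),
      (if ENNReal.ofReal t < c then ENNReal.ofReal (t ^ (p - 1)) else 0) := by
      refine le_trans (le_of_eq ?_) (lintegral_mono_set (show Ioo 0 d ⊆ Ioi 0 from fun t ht => ht.1))
      refine setLIntegral_congr_fun measurableSet_Ioo fun t ht => ?_
      rw [if_pos]
      exact lt_of_lt_of_le ((ENNReal.ofReal_lt_ofReal_iff hd).2 ht.2) hdc
    refine le_trans (le_of_eq ?_) (mul_le_mul_right this _)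
    rw [lint_rpow_Ioo (by linarith) hd, ← ENNReal.ofReal_mul (by linarith),
      ENNReal.ofReal_rpow_of_pos hd]
    congr 1
    rw [show p - 1 + 1 = p by ring]; field_simp
  rcases eq_or_ne c 0 with rfl | h0
  · rw [ENNReal.zero_rpow_of_pos (by linarith)]; exact zero_le
  rcases eq_or_ne c ⊤ with rfl | htop
  · rw [ENNReal.top_rpow_of_pos (by linarith)]
    refine ENNReal.le_of_forall_nnreal_lt fun r _ => ?_
    have := key (max r 1) (by positivity) le_top
    refine le_trans ?_ this
    have h1 : (1:ℝ≥0∞) ≤ ENNReal.ofReal (max (r:ℝ) 1) := by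
      rw [← ENNReal.ofReal_one]; exact ENNReal.ofReal_le_ofReal (le_max_right _ _)
    have h2 : (r:ℝ≥0∞) ≤ ENNReal.ofReal (max (r:ℝ) 1) := by
      rw [← ENNReal.ofReal_coe_nnreal]; exact ENNReal.ofReal_le_ofReal (le_max_left _ _)
    calc (r:ℝ≥0∞) ≤ ENNReal.ofReal (max (r:ℝ) 1) := h2
      _ = ENNReal.ofReal (max (r:ℝ) 1) ^ (1:ℝ) := (ENNReal.rpow_one _).symm
      _ ≤ _ := ENNReal.rpow_le_rpow_of_exponent_le h1 hp.le
  · have := key c.toReal (ENNReal.toReal_pos h0 htop) (ENNReal.ofReal_toReal htop).le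
    rwa [ENNReal.ofReal_toReal htop] at this

/-- layer cake, lower -/
lemma cake_lower {p : ℝ} (hp : 1 < p) (c : ℝ≥0∞) :
    ∫⁻ t in Ioi (0:ℝ), (if ENNReal.ofReal t < 2 * c then ENNReal.ofReal (t ^ (p - 2)) else 0)
     ≤ ENNReal.ofReal (2 ^ (p - 1) / (p - 1)) * c ^ (p - 1) := by
  have hpos : 0 < 2 ^ (p - 1) / (p - 1) := by
    have : 0 < p - 1 := by linarith
    positivity
  rcases eq_or_ne c 0 with rfl | h0
  · simp
  rcases eq_or_ne c ⊤ with rfl | htop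
  · have h3 : ENNReal.ofReal (2 ^ (p - 1) / (p - 1)) ≠ 0 := (ENNReal.ofReal_pos.2 hpos).ne'
    rw [ENNReal.top_rpow_of_pos (by linarith), ENNReal.mul_top h3]
    exact le_top
  · set d := c.toReal
    have hd : 0 < d := ENNReal.toReal_pos h0 htop
    have hc : c = ENNReal.ofReal d := (ENNReal.ofReal_toReal htop).symm
    rw [hc, show (2:ℝ≥0∞) * ENNReal.ofReal d = ENNReal.ofReal (2 * d) by
      rw [ENNReal.ofReal_mul (by norm_num)]; simp]
    have : ∫⁻ t in Ioi (0:ℝ),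
        (if ENNReal.ofReal t < ENNReal.ofReal (2 * d) then ENNReal.ofReal (t ^ (p - 2)) else 0)
        ≤ ∫⁻ t in Ioo 0 (2 * d), ENNReal.ofReal (t ^ (p - 2)) := by
      rw [← lintegral_indicator measurableSet_Ioi, ← lintegral_indicator measurableSet_Ioo]
      refine lintegral_mono fun t => ?_
      simp only [indicator, mem_Ioi, mem_Ioo]
      by_cases ht : 0 < t
      · rw [if_pos ht]
        by_cases h2 : t < 2 * d
        · rw [if_pos ((ENNReal.ofReal_lt_ofReal_iff (by positivity)).2 h2), if_pos (And.intro ht h2)]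
        · rw [if_neg]
          · exact zero_le
          · rw [ENNReal.ofReal_lt_ofReal_iff (by positivity)]; exact h2
      · rw [if_neg ht]; exact zero_le
    refine this.trans (le_of_eq ?_)
    rw [lint_rpow_Ioo (by linarith) (by positivity), ENNReal.ofReal_rpow_of_pos hd,
      ← ENNReal.ofReal_mul hpos.le]
    congr 1
    rw [show p - 2 + 1 = p - 1 by ring, Real.mul_rpow (by norm_num) hd.le]; ring

/-- the (dyadic, left) maximal function -/
def lmax (ℓ : ℝ) (h : ℝ → ℝ≥0∞) (x : ℝ) : ℝ≥0∞ :=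
  ⨆ k : ℕ, lphi h x (ℓ * (1 / 2) ^ k) / ENNReal.ofReal (ℓ * (1 / 2) ^ k)

lemma measurable_lphi (h : ℝ → ℝ≥0∞) (hh : Measurable h) (t : ℝ) :
    Measurable fun x => lphi h x t := by
  have : (fun x => lphi h x t) =
      fun x => ∫⁻ y, (if x - t < y ∧ y ≤ x then h y else 0) := by
    ext x
    rw [lphi, ← lintegral_indicator measurableSet_Ioc]
    congr 1; ext y; simp [indicator, mem_Ioc]
  rw [this]
  apply Measurable.lintegral_prod_right' (f := fun z : ℝ × ℝ =>
    (if z.1 - t < z.2 ∧ z.2 ≤ z.1 then h z.2 else 0))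
  refine Measurable.ite ?_ (by fun_prop) measurable_const
  have m1 : MeasurableSet {z : ℝ × ℝ | z.1 - t < z.2} :=
    measurableSet_lt (by fun_prop) (by fun_prop)
  have m2 : MeasurableSet {z : ℝ × ℝ | z.2 ≤ z.1} :=
    measurableSet_le (by fun_prop) (by fun_prop)
  exact m1.inter m2

lemma measurable_lmax (ℓ : ℝ) (h : ℝ → ℝ≥0∞) (hh : Measurable h) : Measurable (lmax ℓ h) :=
  Measurable.iSup fun _ => (measurable_lphi h hh _).div_const _

lemma lphi_mono (h : ℝ → ℝ≥0∞) (x : ℝ) {s t : ℝ} (hst : s ≤ t) : lphi h x s ≤ lphi h x t :=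
  lintegral_mono_set (Ioc_subset_Ioc_left (by linarith))

lemma lphi_le_lmax {ℓ : ℝ} (hℓ : 0 < ℓ) (h : ℝ → ℝ≥0∞) (x : ℝ) {t : ℝ} (ht : 0 < t)
    (htl : t ≤ ℓ) : lphi h x t ≤ ENNReal.ofReal t * (2 * lmax ℓ h x) := by
  obtain ⟨k, hk1, hk2⟩ := exists_nat_pow_near_of_lt_one (x := t / ℓ) (y := (1 / 2 : ℝ))
    (by positivity) ((div_le_one hℓ).2 htl) (by norm_num) (by norm_num)
  rw [lt_div_iff₀ hℓ] at hk1
  rw [div_le_iff₀ hℓ] at hk2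
  set r := ℓ * (1 / 2 : ℝ) ^ k with hr
  have hr0 : 0 < r := by positivity
  have h1 : lphi h x r / ENNReal.ofReal r ≤ lmax ℓ h x :=
    le_iSup (fun k : ℕ => lphi h x (ℓ * (1 / 2) ^ k) / ENNReal.ofReal (ℓ * (1 / 2) ^ k)) k
  rw [ENNReal.div_le_iff (ENNReal.ofReal_pos.2 hr0).ne' ENNReal.ofReal_ne_top] at h1
  refine (lphi_mono h x (t := r) (by rw [hr]; linarith)).trans (h1.trans ?_)
  have h2 : ENNReal.ofReal r ≤ ENNReal.ofReal t * 2 := by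
    rw [show (2:ℝ≥0∞) = ENNReal.ofReal 2 by simp, ← ENNReal.ofReal_mul ht.le]
    apply ENNReal.ofReal_le_ofReal
    rw [pow_succ] at hk1
    rw [hr]; linarith
  calc lmax ℓ h x * ENNReal.ofReal r ≤ lmax ℓ h x * (ENNReal.ofReal t * 2) :=
        mul_le_mul_right h2 _
    _ = _ := by ring

lemma weak_type {ℓ : ℝ} (hℓ : 0 < ℓ) (h : ℝ → ℝ≥0∞) (hh : Measurable h) {c : ℝ} (hc : 0 < c) :
    volume {x | ENNReal.ofReal c < lmax ℓ h x} ≤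
      ENNReal.ofReal (20 / c) * ∫⁻ y, (if ENNReal.ofReal c < 2 * h y then h y else 0) := by
  set g : ℝ → ℝ≥0∞ := fun y => if ENNReal.ofReal c < 2 * h y then h y else 0 with hg
  have hgm : Measurable g :=
    Measurable.ite (measurableSet_lt (by fun_prop) (by fun_prop)) hh measurable_const
  have hle : ∀ y, h y ≤ g y + ENNReal.ofReal (c / 2) := by
    intro y
    simp only [hg]
    split_ifs with h1
    · exact le_self_add
    · rw [zero_add, ENNReal.ofReal_div_of_pos (by norm_num), ENNReal.le_div_iff_mul_le (by simp) (by simp)]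
      rw [mul_comm]; simpa using h1
  let r : ℝ × ℕ → ℝ := fun z => ℓ * (1 / 2) ^ z.2
  have hr0 : ∀ z, 0 < r z := fun z => by simp only [r]; positivity
  let T : Set (ℝ × ℕ) := {z | ENNReal.ofReal (c / 2 * r z) ≤ lphi g z.1 (r z)}
  obtain ⟨u, huT, hdis, hcov⟩ := Vitali.exists_disjoint_subfamily_covering_enlargement_closedBall
    T (fun z => z.1) r ℓ (fun z _ => by
      have : (1 / 2 : ℝ) ^ z.2 ≤ 1 := pow_le_one₀ (by norm_num) (by norm_num)
      simp only [r]; nlinarith) 5 (by norm_num)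
  have hcount : u.Countable := by
    refine hdis.countable_of_nonempty_interior fun z _ => ?_
    rw [interior_closedBall _ (hr0 z).ne']
    exact ⟨z.1, Metric.mem_ball_self (hr0 z)⟩
  have hsub : {x | ENNReal.ofReal c < lmax ℓ h x} ⊆
      ⋃ z ∈ u, Metric.closedBall z.1 (5 * r z) := by
    intro x hx
    simp only [mem_ofPred_eq, lmax, lt_iSup_iff] at hx
    obtain ⟨k, hk⟩ := hx
    have hmem : (x, k) ∈ T := by
      have hrk := hr0 (x, k)
      change ENNReal.ofReal c < lphi h x (r (x, k)) / ENNReal.ofReal (r (x, k)) at hk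
      change ENNReal.ofReal (c / 2 * r (x, k)) ≤ lphi g x (r (x, k))
      set ρ := r (x, k)
      rw [ENNReal.lt_div_iff_mul_lt (Or.inl (ENNReal.ofReal_pos.2 hrk).ne')
        (Or.inl ENNReal.ofReal_ne_top), ← ENNReal.ofReal_mul hc.le] at hk
      have h2 : lphi h x ρ ≤ lphi g x ρ + ENNReal.ofReal (c / 2 * ρ) := by
        refine (lintegral_mono fun y => hle y).trans ?_
        rw [lintegral_add_left hgm, lintegral_const, Measure.restrict_apply_univ, Real.volume_Ioc,
          ← ENNReal.ofReal_mul (by positivity), sub_sub_cancel]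
        rfl
      have h3 : ENNReal.ofReal (c * ρ) = ENNReal.ofReal (c / 2 * ρ) + ENNReal.ofReal (c / 2 * ρ) := by
        rw [← ENNReal.ofReal_add (by positivity) (by positivity)]; congr 1; ring
      rw [h3] at hk
      exact (lt_of_add_lt_add_right (hk.trans_le h2)).le
    obtain ⟨z, hz, hzs⟩ := hcov _ hmem
    exact mem_biUnion hz (hzs (Metric.mem_closedBall_self (hr0 (x, k)).le))
  calc volume {x | ENNReal.ofReal c < lmax ℓ h x}
      ≤ volume (⋃ z ∈ u, Metric.closedBall z.1 (5 * r z)) := measure_mono hsub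
    _ ≤ ∑' z : u, volume (Metric.closedBall (z : ℝ × ℕ).1 (5 * r z)) :=
        measure_biUnion_le _ hcount _
    _ ≤ ∑' z : u, ENNReal.ofReal (20 / c) * ∫⁻ y in Metric.closedBall (z : ℝ × ℕ).1 (r z), g y := by
        refine ENNReal.tsum_le_tsum fun z => ?_
        have hz : ENNReal.ofReal (c / 2 * r z) ≤ lphi g (z : ℝ × ℕ).1 (r z) := huT z.2
        have hz2 : lphi g (z : ℝ × ℕ).1 (r z) ≤
            ∫⁻ y in Metric.closedBall (z : ℝ × ℕ).1 (r z), g y := by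
          apply lintegral_mono_set
          rw [Real.closedBall_eq_Icc]
          intro y hy
          exact ⟨hy.1.le, by linarith [hy.2, hr0 z]⟩
        refine le_trans (le_of_eq ?_) (mul_le_mul_right (hz.trans hz2) _)
        rw [Real.volume_closedBall, ← ENNReal.ofReal_mul (by positivity)]
        congr 1; field_simp; ring
    _ = ENNReal.ofReal (20 / c) * ∫⁻ y in ⋃ z ∈ u, Metric.closedBall z.1 (r z), g y := by
        rw [ENNReal.tsum_mul_left, lintegral_biUnion hcount
          (fun z _ => Metric.isClosed_closedBall.measurableSet) hdis]
    _ ≤ _ := mul_le_mul_right (setLIntegral_le_lintegral _ _) _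

lemma strong_type {ℓ p : ℝ} (hℓ : 0 < ℓ) (hp : 1 < p) (h : ℝ → ℝ≥0∞) (hh : Measurable h) :
    ∫⁻ x, lmax ℓ h x ^ p ≤
      ENNReal.ofReal (p * 20 * (2 ^ (p - 1) / (p - 1))) * ∫⁻ y, h y ^ p := by
  have hM := measurable_lmax ℓ h hh
  have hp1 : 0 < p - 1 := by linarith
  calc ∫⁻ x, lmax ℓ h x ^ p
      ≤ ∫⁻ x, ENNReal.ofReal p * ∫⁻ t in Ioi (0:ℝ),
      (if ENNReal.ofReal t < lmax ℓ h x then ENNReal.ofReal (t ^ (p - 1)) else 0) :=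
        lintegral_mono fun x => cake_upper hp _
    _ = ENNReal.ofReal p * ∫⁻ t in Ioi (0:ℝ), ∫⁻ x,
      (if ENNReal.ofReal t < lmax ℓ h x then ENNReal.ofReal (t ^ (p - 1)) else 0) := by
        rw [lintegral_const_mul' _ _ ENNReal.ofReal_ne_top, lintegral_lintegral_swap]
        apply Measurable.aemeasurable
        exact Measurable.ite (measurableSet_lt (by fun_prop) (by fun_prop)) (by fun_prop)
          measurable_const
    _ ≤ ENNReal.ofReal p * ∫⁻ t in Ioi (0:ℝ), ENNReal.ofReal 20 *
        ∫⁻ y, (if ENNReal.ofReal t < 2 * h y then ENNReal.ofReal (t ^ (p - 2)) else 0) * h y := by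
        refine mul_le_mul_right ?_ _
        apply setLIntegral_mono_ae' measurableSet_Ioi
        refine Filter.Eventually.of_forall fun t ht => ?_
        have ht0 : 0 < t := ht
        have e1 : ∫⁻ x, (if ENNReal.ofReal t < lmax ℓ h x then ENNReal.ofReal (t ^ (p - 1)) else 0)
            = ENNReal.ofReal (t ^ (p - 1)) * volume {x | ENNReal.ofReal t < lmax ℓ h x} := by
          rw [← lintegral_indicator_const (measurableSet_lt measurable_const hM)]
          congr 1; ext x; simp [indicator]
        have e2 : ∫⁻ y, (if ENNReal.ofReal t < 2 * h y then ENNReal.ofReal (t ^ (p - 2)) else 0) * h y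
            = ENNReal.ofReal (t ^ (p - 2)) *
              ∫⁻ y, (if ENNReal.ofReal t < 2 * h y then h y else 0) := by
          rw [← lintegral_const_mul' _ _ ENNReal.ofReal_ne_top]
          congr 1; ext y; split_ifs <;> simp
        rw [e1, e2]
        refine (mul_le_mul_right (weak_type hℓ h hh ht0) _).trans (le_of_eq ?_)
        rw [← mul_assoc, ← mul_assoc, ← ENNReal.ofReal_mul (by positivity),
          ← ENNReal.ofReal_mul (by norm_num)]
        congr 2
        rw [show p - 1 = (p - 2) + 1 by ring, Real.rpow_add_one ht0.ne']
        field_simp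
    _ = ENNReal.ofReal p * (ENNReal.ofReal 20 * ∫⁻ y, (∫⁻ t in Ioi (0:ℝ),
        (if ENNReal.ofReal t < 2 * h y then ENNReal.ofReal (t ^ (p - 2)) else 0)) * h y) := by
        rw [lintegral_const_mul' _ _ ENNReal.ofReal_ne_top, lintegral_lintegral_swap]
        · congr 3; ext y
          rw [lintegral_mul_const]
          exact Measurable.ite (measurableSet_lt (by fun_prop) (by fun_prop)) (by fun_prop)
            measurable_const
        · apply Measurable.aemeasurable
          refine Measurable.mul ?_ (by fun_prop)
          exact Measurable.ite (measurableSet_lt (by fun_prop) (by fun_prop)) (by fun_prop)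
            measurable_const
    _ ≤ ENNReal.ofReal p * (ENNReal.ofReal 20 * ∫⁻ y,
          ENNReal.ofReal (2 ^ (p - 1) / (p - 1)) * h y ^ p) := by
        refine mul_le_mul_right (mul_le_mul_right (lintegral_mono fun y => ?_) _) _
        refine (mul_le_mul_left (cake_lower hp (h y)) _).trans (le_of_eq ?_)
        rw [mul_assoc]
        congr 1
        nth_rewrite 2 [← ENNReal.rpow_one (h y)]
        rw [← ENNReal.rpow_add_of_nonneg _ _ hp1.le zero_le_one]
        congr 1; ring
    _ = _ := by
        rw [lintegral_const_mul' _ _ ENNReal.ofReal_ne_top, ← mul_assoc, ← mul_assoc,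
          ← ENNReal.ofReal_mul (by positivity), ← ENNReal.ofReal_mul (by positivity)]

lemma lphi_le_of_ge (h : ℝ → ℝ≥0∞) (h0 : ∀ y ≤ 0, h y = 0) (x t : ℝ) :
    lphi h x t ≤ lphi h x x := by
  rw [lphi, lphi, ← lintegral_indicator measurableSet_Ioc, ← lintegral_indicator measurableSet_Ioc]
  refine lintegral_mono fun y => ?_
  by_cases hy : y ∈ Ioc (x - x) x
  · rw [indicator_of_mem hy]; exact indicator_le_self _ _ _
  · rw [indicator_of_notMem hy]
    by_cases hy2 : y ≤ x
    · have : y ≤ 0 := by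
        by_contra h3
        exact hy ⟨by simpa using h3, hy2⟩
      exact (indicator_le_self _ _ _).trans (h0 y this).le
    · rw [indicator_of_notMem (fun h3 => hy2 h3.2)]

lemma lphi_bound1 {ℓ : ℝ} (h : ℝ → ℝ≥0∞) (h0 : ∀ y ≤ 0, h y = 0) {x : ℝ}
    (hx : x ∈ Ioc 0 ℓ) (t : ℝ) (ht : 0 < t) :
    lphi h x t ≤ ENNReal.ofReal t * (2 * lmax ℓ h x) := by
  have hℓ : 0 < ℓ := hx.1.trans_le hx.2
  rcases le_total t x with h1 | h1
  · exact lphi_le_lmax hℓ h x ht (h1.trans hx.2)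
  · exact (lphi_le_of_ge h h0 x t).trans ((lphi_le_lmax hℓ h x hx.1 hx.2).trans
      (mul_le_mul_left (ENNReal.ofReal_le_ofReal h1) _))

lemma lphi_bound2 {ℓ : ℝ} (h : ℝ → ℝ≥0∞) (h0 : ∀ y ≤ 0, h y = 0) {x : ℝ}
    (hx : x ∈ Ioc 0 ℓ) (t : ℝ) :
    lphi h x t ≤ ENNReal.ofReal (t ^ (0:ℝ)) * (ENNReal.ofReal x * (2 * lmax ℓ h x)) := by
  have hℓ : 0 < ℓ := hx.1.trans_le hx.2
  simp only [Real.rpow_zero, ENNReal.ofReal_one, one_mul]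
  exact (lphi_le_of_ge h h0 x t).trans (lphi_le_lmax hℓ h x hx.1 hx.2)

lemma lphi_holder {p : ℝ} (hp : 1 < p) (h : ℝ → ℝ≥0∞) (hh : Measurable h) (x t : ℝ) (ht : 0 < t) :
    lphi h x t ≤ ENNReal.ofReal (t ^ (1 - 1 / p)) * (∫⁻ y, h y ^ p) ^ (1 / p) := by
  have hc := Real.HolderConjugate.conjExponent hp
  have := ENNReal.lintegral_mul_le_Lp_mul_Lq (volume.restrict (Ioc (x - t) x)) hc
    hh.aemeasurable (measurable_const (a := (1:ℝ≥0∞))).aemeasurable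
  simp only [Pi.mul_apply, mul_one, ENNReal.one_rpow, lintegral_const, one_mul,
    Measure.restrict_apply_univ, Real.volume_Ioc, sub_sub_cancel] at this
  rw [ENNReal.ofReal_rpow_of_pos ht] at this
  refine this.trans ?_
  rw [mul_comm]
  have e : 1 / p.conjExponent = 1 - 1 / p := by
    have := hc.inv_add_inv_eq_one
    simp only [one_div]; linarith
  rw [e]
  gcongr
  exact Measure.restrict_le_self

lemma hedberg {ℓ p q : ℝ} (hp : 1 < p) (hpq : p < q) (h : ℝ → ℝ≥0∞) (hh : Measurable h)
    (h0 : ∀ y ≤ 0, h y = 0) {x : ℝ} (hx : x ∈ Ioc 0 ℓ) (hN : ∫⁻ y, h y ^ p ≠ ⊤) :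
    ∫⁻ y in Iic x, ENNReal.ofReal ((x - y) ^ (-(1 - 1 / p + 1 / q))) * h y ≤
      ENNReal.ofReal (1 - 1 / p + 1 / q) * (ENNReal.ofReal (1 / (1 / p - 1 / q)) +
        ENNReal.ofReal q) * (((∫⁻ y, h y ^ p) ^ (1 / p)) ^ (1 - p / q) *
          (2 * lmax ℓ h x) ^ (p / q)) := by
  have hp0 : 0 < p := by linarith
  have hq0 : 0 < q := by linarith
  have hpi : 1 / p < 1 := by rw [div_lt_one hp0]; exact hp
  have hqi : 0 < 1 / q := by positivity
  have hqp : 1 / q < 1 / p := one_div_lt_one_div_of_lt hp0 hpq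
  have hpq1 : p / q < 1 := (div_lt_one hq0).2 hpq
  have hpq0 : 0 < p / q := by positivity
  set s := 1 - 1 / p + 1 / q with hs
  have hs0 : 0 < s := by linarith
  refine (kernel_le hs0 h hh x).trans ?_
  rw [mul_assoc]
  refine mul_le_mul_right ?_ _
  set N := (∫⁻ y, h y ^ p) ^ (1 / p) with hNdef
  have hNtop : N ≠ ⊤ := ENNReal.rpow_ne_top_of_nonneg (by positivity) hN
  set A := 2 * lmax ℓ h x
  have b1 := lphi_bound1 h h0 hx
  have b2 := lphi_holder hp h hh x
  have zero_case : (∀ t, 0 < t → lphi h x t ≤ 0) →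
      ∫⁻ t in Ioi 0, ENNReal.ofReal (t ^ (-s - 1)) * lphi h x t = 0 := by
    intro hz
    rw [setLIntegral_congr_fun (g := fun _ => 0) measurableSet_Ioi
      (fun t ht => by simp [le_antisymm (hz t ht) zero_le])]
    simp
  rcases eq_or_ne A 0 with hA0 | hA0
  · rw [zero_case fun t ht => (b1 t ht).trans (by change _ * A ≤ 0; simp [hA0])]; exact zero_le
  rcases eq_or_ne N 0 with hN0 | hN0
  · rw [zero_case fun t ht => (b2 t ht).trans (by change _ * N ≤ 0; simp [hN0])]; exact zero_le
  rcases eq_or_ne A ⊤ with hAt | hAt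
  · rw [hAt, ENNReal.top_rpow_of_pos hpq0, ENNReal.mul_top, ENNReal.mul_top]
    · exact le_top
    · have : ENNReal.ofReal q ≠ 0 := (ENNReal.ofReal_pos.2 hq0).ne'
      simp [this]
    · exact (ENNReal.rpow_pos (pos_iff_ne_zero.2 hN0) hNtop).ne'
  have hn : 0 < N.toReal := ENNReal.toReal_pos hN0 hNtop
  have hα : 0 < A.toReal := ENNReal.toReal_pos hA0 hAt
  have hr : 0 < (N.toReal / A.toReal) ^ p := by positivity
  refine (split_est (b := s) (θ := 1 - 1 / p) (by linarith) (by linarith) hr _ A N b1 b2).trans ?_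
  have eA : A = ENNReal.ofReal A.toReal := (ENNReal.ofReal_toReal hAt).symm
  have eN : N = ENNReal.ofReal N.toReal := (ENNReal.ofReal_toReal hNtop).symm
  generalize N.toReal = n at *
  generalize A.toReal = α at *
  rw [eA, eN, add_mul, ENNReal.ofReal_rpow_of_pos hn, ENNReal.ofReal_rpow_of_pos hα,
    ← ENNReal.ofReal_mul (p := ((n / α) ^ p) ^ (1 - s)) (by positivity),
    ← ENNReal.ofReal_mul (p := ((n / α) ^ p) ^ (1 - 1 / p - s)) (by positivity),
    ← ENNReal.ofReal_mul (p := n ^ (1 - p / q)) (by positivity)]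
  rw [show 1 - s = 1 / p - 1 / q by rw [hs]; ring, show 1 - 1 / p - s = - (1 / q) by rw [hs]; ring,
    show s - (1 - 1 / p) = 1 / q by rw [hs]; ring, one_div_one_div]
  have i1 : ((n / α) ^ p) ^ (1 / p - 1 / q) * α = n ^ (1 - p / q) * α ^ (p / q) := by
    rw [← Real.rpow_mul (by positivity), show p * (1 / p - 1 / q) = 1 - p / q by field_simp,
      Real.div_rpow hn.le hα.le, Real.rpow_sub hα, Real.rpow_one]
    field_simp
  have i2 : ((n / α) ^ p) ^ (-(1 / q)) * n = n ^ (1 - p / q) * α ^ (p / q) := by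
    rw [← Real.rpow_mul (by positivity), show p * (-(1 / q)) = - (p / q) by ring,
      Real.div_rpow hn.le hα.le, Real.rpow_sub hn, Real.rpow_one, Real.rpow_neg hn.le,
      Real.rpow_neg hα.le]
    field_simp
  rw [i1, i2]

lemma hardy_pt {ℓ b : ℝ} (hb0 : 0 < b) (hb1 : b < 1) (h : ℝ → ℝ≥0∞) (hh : Measurable h)
    (h0 : ∀ y ≤ 0, h y = 0) {x : ℝ} (hx : x ∈ Ioc 0 ℓ) :
    ∫⁻ y in Iic x, ENNReal.ofReal ((x - y) ^ (-b)) * h y ≤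
      ENNReal.ofReal b * (ENNReal.ofReal (1 / (1 - b)) + ENNReal.ofReal (1 / b)) *
        (ENNReal.ofReal (x ^ (1 - b)) * (2 * lmax ℓ h x)) := by
  refine (kernel_le hb0 h hh x).trans ?_
  rw [mul_assoc]
  refine mul_le_mul_right ?_ _
  have := split_est (b := b) (θ := 0) hb1 hb0 hx.1 _ _ _ (lphi_bound1 h h0 hx)
    (fun t _ => lphi_bound2 h h0 hx t)
  refine this.trans (le_of_eq ?_)
  rw [add_mul, sub_zero, ← mul_assoc (ENNReal.ofReal (x ^ (0 - b))),
    ← ENNReal.ofReal_mul (Real.rpow_nonneg hx.1.le _), ← Real.rpow_add_one hx.1.ne']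
  congr 5; ring

lemma conclude {ℓ p q : ℝ} (hℓ : 0 < ℓ) (hp : 1 < p) (hpq : p ≤ q) (h S : ℝ → ℝ≥0∞)
    (hh : Measurable h) (K : ℝ≥0∞) (hK : K ≠ ⊤)
    (hS : ∀ x ∈ Ioc 0 ℓ, S x ≤ K * (((∫⁻ y, h y ^ p) ^ (1 / p)) ^ (1 - p / q) *
          (2 * lmax ℓ h x) ^ (p / q))) :
    (∫⁻ x in Ioc 0 ℓ, S x ^ q) ^ (1 / q) ≤
      (K ^ q * (2 ^ p * ENNReal.ofReal (p * 20 * (2 ^ (p - 1) / (p - 1))))) ^ (1 / q) *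
        (∫⁻ y, h y ^ p) ^ (1 / p) := by
  have hp0 : 0 < p := by linarith
  have hq0 : 0 < q := by linarith
  set I := ∫⁻ y, h y ^ p with hI
  set N := I ^ (1 / p) with hN
  have hIN : I = N ^ p := by
    rw [hN, ← ENNReal.rpow_mul, one_div_mul_cancel hp0.ne', ENNReal.rpow_one]
  set D := ENNReal.ofReal (p * 20 * (2 ^ (p - 1) / (p - 1)))
  have hM := measurable_lmax ℓ h hh
  have key : ∫⁻ x in Ioc 0 ℓ, S x ^ q ≤ K ^ q * (2 ^ p * D) * N ^ q := by
    calc ∫⁻ x in Ioc 0 ℓ, S x ^ q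
        ≤ ∫⁻ x in Ioc 0 ℓ, (K ^ q * (N ^ (q - p) * 2 ^ p)) * lmax ℓ h x ^ p := by
          apply setLIntegral_mono_ae' measurableSet_Ioc
          refine Filter.Eventually.of_forall fun x hx => ?_
          refine (ENNReal.rpow_le_rpow (hS x hx) hq0.le).trans (le_of_eq ?_)
          rw [ENNReal.mul_rpow_of_nonneg _ _ hq0.le, ENNReal.mul_rpow_of_nonneg _ _ hq0.le,
            ← ENNReal.rpow_mul N, ← ENNReal.rpow_mul (2 * lmax ℓ h x), div_mul_cancel₀ _ hq0.ne',
            show (1 - p / q) * q = q - p by field_simp, ENNReal.mul_rpow_of_nonneg _ _ hp0.le]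
          ring
      _ ≤ ∫⁻ x, (K ^ q * (N ^ (q - p) * 2 ^ p)) * lmax ℓ h x ^ p := setLIntegral_le_lintegral _ _
      _ = (K ^ q * (N ^ (q - p) * 2 ^ p)) * ∫⁻ x, lmax ℓ h x ^ p :=
          lintegral_const_mul _ (hM.pow_const _)
      _ ≤ (K ^ q * (N ^ (q - p) * 2 ^ p)) * (D * N ^ p) := by
          rw [← hIN]
          exact mul_le_mul_right (strong_type hℓ hp h hh) _
      _ = K ^ q * (2 ^ p * D) * (N ^ (q - p) * N ^ p) := by ring
      _ = _ := by
          rw [← ENNReal.rpow_add_of_nonneg _ _ (by linarith) hp0.le, sub_add_cancel]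
  refine (ENNReal.rpow_le_rpow key (by positivity)).trans (le_of_eq ?_)
  rw [ENNReal.mul_rpow_of_nonneg _ _ (by positivity : 0 ≤ 1 / q), ← ENNReal.rpow_mul N,
    mul_one_div_cancel hq0.ne', ENNReal.rpow_one]

lemma final_wrap {ℓ p q a b : ℝ} (hℓ : 0 < ℓ) (hp : 1 < p) (hpq : p ≤ q) (K : ℝ≥0∞) (hK : K ≠ ⊤)
    (H : ∀ h : ℝ → ℝ≥0∞, Measurable h → (∀ y ≤ 0, h y = 0) → ∫⁻ y, h y ^ p ≠ ⊤ →
      ∀ x ∈ Ioc 0 ℓ, ENNReal.ofReal (x ^ (-a)) *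
            ∫⁻ y in Iic x, ENNReal.ofReal ((x - y) ^ (-b)) * h y ≤
        K * (((∫⁻ y, h y ^ p) ^ (1 / p)) ^ (1 - p / q) * (2 * lmax ℓ h x) ^ (p / q))) :
    ∃ C : ℝ, ∀ f : ℝ → ℝ≥0∞, Measurable f →
      (∫⁻ x in Ioc (0 : ℝ) ℓ,
          (ENNReal.ofReal (x ^ (-a)) *
            ∫⁻ y in Ioc (0 : ℝ) x, ENNReal.ofReal ((x - y) ^ (-b)) * f y) ^ q) ^ (1 / q) ≤
        ENNReal.ofReal C * (∫⁻ y in Ioc (0 : ℝ) ℓ, f y ^ p) ^ (1 / p) := by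
  have hp0 : 0 < p := by linarith
  have hq0 : 0 < q := by linarith
  set D := (K ^ q * (2 ^ p * ENNReal.ofReal (p * 20 * (2 ^ (p - 1) / (p - 1))))) ^ (1 / q) with hD
  have hDt : D ≠ ⊤ := by
    refine ENNReal.rpow_ne_top_of_nonneg (by positivity) (ENNReal.mul_ne_top
      (ENNReal.rpow_ne_top_of_nonneg hq0.le hK) (ENNReal.mul_ne_top
        (ENNReal.rpow_ne_top_of_nonneg hp0.le (by simp)) ENNReal.ofReal_ne_top))
  refine ⟨D.toReal + 1, fun f hf => ?_⟩
  set h := (Ioc 0 ℓ).indicator f with hh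
  have hhm : Measurable h := hf.indicator measurableSet_Ioc
  have hint : ∫⁻ y, h y ^ p = ∫⁻ y in Ioc (0 : ℝ) ℓ, f y ^ p := by
    rw [← lintegral_indicator measurableSet_Ioc]
    congr 1; ext y
    by_cases hy : y ∈ Ioc 0 ℓ <;> simp [hh, hy, hp0]
  rw [← hint]
  by_cases htop : ∫⁻ y, h y ^ p = ⊤
  · rw [htop, ENNReal.top_rpow_of_pos (by positivity), ENNReal.mul_top]
    · exact le_top
    · exact (ENNReal.ofReal_pos.2 (by positivity)).ne'
  have h0 : ∀ y ≤ 0, h y = 0 := fun y hy =>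
    indicator_of_notMem (fun h3 => absurd h3.1 (not_lt.2 hy)) _
  refine (conclude hℓ hp hpq h _ hhm K hK fun x hx => ?_).trans
    (mul_le_mul_left (?_ : D ≤ _) _)
  · refine le_trans (mul_le_mul_right ?_ _) (H h hhm h0 htop x hx)
    refine le_trans (le_of_eq ?_) (lintegral_mono_set (Ioc_subset_Iic_self (a := 0)))
    refine setLIntegral_congr_fun measurableSet_Ioc fun y hy => ?_
    have : h y = f y := indicator_of_mem (show y ∈ Ioc 0 ℓ from ⟨hy.1, hy.2.trans hx.2⟩) _
    simp only [this]
  · refine (ENNReal.ofReal_toReal hDt).symm.le.trans ?_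
    apply ENNReal.ofReal_le_ofReal
    simp

/-- **Lemma (weighted Hardy–Littlewood–Sobolev/Stein–Weiss inequality).** Let `ℓ ∈ (0,∞)`,
`1 < p ≤ q < ∞`, `a ≥ 0`, `0 < b < 1` with `1/p' + 1/q ≥ a + b`. Then the operator
`S_{a,b} f(x) = x^{−a} ∫_0^x (x−y)^{−b} f(y) dy` is bounded from `L^p((0,ℓ])` to
`L^q((0,ℓ])`. -/
theorem stmt14 (ℓ p q a b : ℝ) (hℓ : 0 < ℓ) (hp : 1 < p) (hpq : p ≤ q)
    (ha : 0 ≤ a) (hb0 : 0 < b) (hb1 : b < 1) (hcond : a + b ≤ (1 - 1 / p) + 1 / q) :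
    ∃ C : ℝ, ∀ f : ℝ → ℝ≥0∞, Measurable f →
      (∫⁻ x in Ioc (0 : ℝ) ℓ,
          (ENNReal.ofReal (x ^ (-a)) *
            ∫⁻ y in Ioc (0 : ℝ) x, ENNReal.ofReal ((x - y) ^ (-b)) * f y) ^ q) ^ (1 / q) ≤
        ENNReal.ofReal C * (∫⁻ y in Ioc (0 : ℝ) ℓ, f y ^ p) ^ (1 / p) := by
  have hp0 : 0 < p := by linarith
  rcases hpq.eq_or_lt with rfl | hlt
  · refine final_wrap hℓ hp hpq (ENNReal.ofReal (ℓ ^ (1 - a - b)) *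
      (ENNReal.ofReal b * (ENNReal.ofReal (1 / (1 - b)) + ENNReal.ofReal (1 / b)))) ?_ ?_
    · exact ENNReal.mul_ne_top ENNReal.ofReal_ne_top (ENNReal.mul_ne_top ENNReal.ofReal_ne_top
        (ENNReal.add_ne_top.2 ⟨ENNReal.ofReal_ne_top, ENNReal.ofReal_ne_top⟩))
    · intro h hh h0 _ x hx
      refine (mul_le_mul_right (hardy_pt hb0 hb1 h hh h0 hx) _).trans ?_
      rw [div_self hp0.ne', sub_self, ENNReal.rpow_zero, ENNReal.rpow_one, one_mul]
      set E := ENNReal.ofReal b * (ENNReal.ofReal (1 / (1 - b)) + ENNReal.ofReal (1 / b))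
      have e : ENNReal.ofReal (x ^ (-a)) * ENNReal.ofReal (x ^ (1 - b)) ≤
          ENNReal.ofReal (ℓ ^ (1 - a - b)) := by
        rw [← ENNReal.ofReal_mul (Real.rpow_nonneg hx.1.le _), ← Real.rpow_add hx.1]
        apply ENNReal.ofReal_le_ofReal
        rw [show -a + (1 - b) = 1 - a - b by ring]
        exact Real.rpow_le_rpow hx.1.le hx.2 (by linarith)
      calc _ = (ENNReal.ofReal (x ^ (-a)) * ENNReal.ofReal (x ^ (1 - b))) * (E * (2 * lmax ℓ h x)) := by
            ring
        _ ≤ ENNReal.ofReal (ℓ ^ (1 - a - b)) * (E * (2 * lmax ℓ h x)) := mul_le_mul_left e _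
        _ = _ := by ring
  · set s := 1 - 1 / p + 1 / q with hs
    refine final_wrap hℓ hp hpq (ENNReal.ofReal (ℓ ^ (s - a - b)) *
      (ENNReal.ofReal s * (ENNReal.ofReal (1 / (1 / p - 1 / q)) +
        ENNReal.ofReal q))) ?_ ?_
    · exact ENNReal.mul_ne_top ENNReal.ofReal_ne_top (ENNReal.mul_ne_top ENNReal.ofReal_ne_top
        (ENNReal.add_ne_top.2 ⟨ENNReal.ofReal_ne_top, ENNReal.ofReal_ne_top⟩))
    · intro h hh h0 hN x hx
      rw [mul_assoc]
      refine le_trans ?_ (mul_le_mul_right (hedberg hp hlt h hh h0 hx hN) _)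
      rw [← lintegral_const_mul' _ _ ENNReal.ofReal_ne_top,
        ← lintegral_const_mul' _ _ ENNReal.ofReal_ne_top]
      apply setLIntegral_mono_ae' measurableSet_Iic
      refine Filter.Eventually.of_forall fun y hy => ?_
      have hy' : y ≤ x := hy
      rcases hy'.eq_or_lt with rfl | hyx
      · simp [Real.zero_rpow (neg_ne_zero.2 hb0.ne')]
      by_cases hy0 : y ≤ 0
      · simp [h0 y hy0]
      push Not at hy0
      have hd : 0 < x - y := by linarith
      rw [← mul_assoc, ← mul_assoc, ← ENNReal.ofReal_mul (Real.rpow_nonneg hx.1.le _),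
        ← ENNReal.ofReal_mul (Real.rpow_nonneg hℓ.le _)]
      refine mul_le_mul_left (ENNReal.ofReal_le_ofReal ?_) _
      calc x ^ (-a) * (x - y) ^ (-b) ≤ (x - y) ^ (-a) * (x - y) ^ (-b) := by
            refine mul_le_mul_of_nonneg_right ?_ (Real.rpow_nonneg hd.le _)
            exact Real.rpow_le_rpow_of_nonpos hd (by linarith) (by linarith)
        _ = (x - y) ^ (s - a - b) * (x - y) ^ (-s) := by
            rw [← Real.rpow_add hd, ← Real.rpow_add hd]; congr 1; ring
        _ ≤ ℓ ^ (s - a - b) * (x - y) ^ (-s) := by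
            refine mul_le_mul_of_nonneg_right ?_ (Real.rpow_nonneg hd.le _)
            exact Real.rpow_le_rpow hd.le (by linarith [hx.2]) (by linarith)
end
end
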